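/- Let G be a simple graph with a vertex v such that every vertex of the induced subgraph G[N(v)] has degree at most 1 in G[N(v)] (so the edges of G inside N(v) form a matching). Let H = V(G) \ N[v]. Then G has a proper 3-coloring in which v receives color 1 if and only if there exists a function c from H to {1,2,3} satisfying: (i) c(x) ≠ c(y) for all adjacent x, y in H; (ii) for all x, y in H that have a common neighbor in N(v), the pair (c(x), c(y)) is neither (2,3) nor (3,2); and (iii) for all x, y in H (possibly x = y) and every edge uw of G with both u, w in N(v), if x is adjacent to u and y is adjacent to w, then the pair (c(x), c(y)) is neither (2,2) nor (3,3). -/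

import Mathlib

/-- Let `v` be a vertex of `G` such that every vertex of `G[N(v)]` has
degree at most 1 inside `N(v)` (the edges inside `N(v)` form a matching), and let
`H = V(G) \ N[v]`. Then `G` has a proper 3-coloring (with colors `{1,2,3}`) in which
`v` gets color 1 iff there is `c : H → {1,2,3}` such that:
(i) `c x ≠ c y` for adjacent `x, y ∈ H`;
(ii) if `x, y ∈ H` have a common neighbor in `N(v)` then `(c x, c y)` is neither
`(2,3)` nor `(3,2)`;
(iii) for all `x, y ∈ H` (possibly equal) and every edge `uw` of `G` with
`u, w ∈ N(v)`, if `x` is adjacent to `u` and `y` is adjacent to `w`, then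
`(c x, c y)` is neither `(2,2)` nor `(3,3)`. -/
theorem stmt_9 {V : Type*} [Fintype V] (G : SimpleGraph V) (v : V)
    (hmatch : ∀ u ∈ G.neighborSet v,
      ({w : V | w ∈ G.neighborSet v ∧ G.Adj u w} : Set V).Subsingleton) :
    (∃ C : V → ℕ, (∀ z : V, C z = 1 ∨ C z = 2 ∨ C z = 3) ∧
        (∀ z z' : V, G.Adj z z' → C z ≠ C z') ∧ C v = 1) ↔
      (∃ c : V → ℕ,
        (∀ x ∈ {z : V | z ∉ insert v (G.neighborSet v)}, c x = 1 ∨ c x = 2 ∨ c x = 3) ∧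
        (∀ x ∈ {z : V | z ∉ insert v (G.neighborSet v)},
          ∀ y ∈ {z : V | z ∉ insert v (G.neighborSet v)},
          G.Adj x y → c x ≠ c y) ∧
        (∀ x ∈ {z : V | z ∉ insert v (G.neighborSet v)},
          ∀ y ∈ {z : V | z ∉ insert v (G.neighborSet v)},
          (∃ u ∈ G.neighborSet v, G.Adj u x ∧ G.Adj u y) →
            ¬(c x = 2 ∧ c y = 3) ∧ ¬(c x = 3 ∧ c y = 2)) ∧
        (∀ x ∈ {z : V | z ∉ insert v (G.neighborSet v)},
          ∀ y ∈ {z : V | z ∉ insert v (G.neighborSet v)},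
          ∀ u ∈ G.neighborSet v, ∀ w ∈ G.neighborSet v,
          G.Adj u w → G.Adj x u → G.Adj y w →
            ¬(c x = 2 ∧ c y = 2) ∧ ¬(c x = 3 ∧ c y = 3))) := by
  classical
  constructor
  · rintro ⟨C, hC, hadj, hv⟩
    have hN : ∀ u, G.Adj v u → C u = 2 ∨ C u = 3 := fun u hu => by
      have := hadj v u hu
      have := hC u
      omega
    refine ⟨C, fun x _ => hC x, fun x _ y _ h => hadj x y h, ?_, ?_⟩
    · rintro x - y - ⟨u, hu, hux, huy⟩
      have := hN u hu
      have := hadj u x hux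
      have := hadj u y huy
      omega
    · intro x _ y _ u hu w hw huw hxu hyw
      have := hN u hu
      have := hN w hw
      have := hadj u w huw
      have := hadj x u hxu
      have := hadj y w hyw
      omega
  · rintro ⟨c, hc, hadj, hcommon, hedge⟩
    simp only [Set.mem_ofPred_eq, Set.mem_insert_iff, SimpleGraph.mem_neighborSet, not_or]
      at hc hadj hcommon hedge hmatch
    let f := Fintype.equivFin V
    -- `sees k u`: the vertex `u` has a neighbor of color `k` outside `N[v]`.
    let sees (k : ℕ) (u : V) : Prop := ∃ x, (x ≠ v ∧ ¬G.Adj v x) ∧ G.Adj u x ∧ c x = k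
    have not_sees_both : ∀ u, G.Adj v u → sees 3 u → ¬sees 2 u := by
      rintro u hu ⟨x, hx, hux, hcx⟩ ⟨y, hy, huy, hcy⟩
      exact (hcommon x hx y hy ⟨u, hu, hux, huy⟩).2 ⟨hcx, hcy⟩
    have not_sees_two : ∀ u w, G.Adj v u → G.Adj v w → G.Adj u w → sees 2 u → ¬sees 2 w := by
      rintro u w hu hw huw ⟨x, hx, hux, hcx⟩ ⟨y, hy, hwy, hcy⟩
      exact (hedge x hx y hy u hu w hw huw hux.symm hwy.symm).1 ⟨hcx, hcy⟩
    have not_sees_three : ∀ u w, G.Adj v u → G.Adj v w → G.Adj u w → sees 3 u → ¬sees 3 w := by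
      rintro u w hu hw huw ⟨x, hx, hux, hcx⟩ ⟨y, hy, hwy, hcy⟩
      exact (hedge x hx y hy u hu w hw huw hux.symm hwy.symm).2 ⟨hcx, hcy⟩
    -- The neighbors of `v` that receive color `2`; ties along an edge are broken by `f`.
    let P (u : V) : Prop := sees 3 u ∨
      (¬sees 2 u ∧ ∀ w, G.Adj v w → G.Adj u w → ¬sees 3 w ∧ (sees 2 w ∨ f u < f w))
    have P_of_edge : ∀ u w, G.Adj v u → G.Adj v w → G.Adj u w →
        (P u ↔ sees 3 u ∨ (¬sees 2 u ∧ ¬sees 3 w ∧ (sees 2 w ∨ f u < f w))) := by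
      intro u w hu hw huw
      refine or_congr_right (and_congr_right fun _ => ⟨fun h => h w hw huw, ?_⟩)
      intro h w' hw' huw'
      rwa [hmatch u hu ⟨hw', huw'⟩ ⟨hw, huw⟩]
    have P_edge : ∀ u w, G.Adj v u → G.Adj v w → G.Adj u w → (P u ↔ ¬P w) := by
      intro u w hu hw huw
      rw [P_of_edge u w hu hw huw, P_of_edge w u hw hu huw.symm]
      have h₁ := not_sees_both u hu
      have h₂ := not_sees_both w hw
      have h₃ := not_sees_two u w hu hw huw
      have h₄ := not_sees_three u w hu hw huw
      have h₅ : f u < f w ↔ ¬f w < f u := by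
        have : f u ≠ f w := f.injective.ne huw.ne
        omega
      generalize sees 2 u = a, sees 3 u = b, sees 2 w = a', sees 3 w = b' at *
      rw [h₅]
      by_cases a <;> by_cases b <;> by_cases a' <;> by_cases b' <;>
        simp_all only [not_true_eq_false, not_false_eq_true, true_or, or_true, and_true, true_and,
          false_or, or_false, and_false, false_and, imp_false, forall_const]
    have not_sees_two_of_P : ∀ u, G.Adj v u → P u → ¬sees 2 u := by
      rintro u hu (h | h)
      exacts [not_sees_both u hu h, h.1]
    let C (z : V) : ℕ := if z = v then 1 else if G.Adj v z then (if P z then 2 else 3) else c z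
    have C_self : C v = 1 := if_pos rfl
    have C_nbr : ∀ u, G.Adj v u → C u = if P u then 2 else 3 := fun u hu => by
      simp only [C, if_neg hu.ne', if_pos hu]
    have C_far : ∀ x, x ≠ v → ¬G.Adj v x → C x = c x := fun x hx hvx => by
      simp only [C, if_neg hx, if_neg hvx]
    have C_self_nbr : ∀ u, G.Adj v u → C v ≠ C u := fun u hu => by
      rw [C_self, C_nbr u hu]
      split_ifs <;> decide
    have C_nbr_far : ∀ u x, G.Adj v u → x ≠ v → ¬G.Adj v x → G.Adj u x → C u ≠ C x := by
      intro u x hu hx hvx hux h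
      rw [C_nbr u hu, C_far x hx hvx] at h
      split_ifs at h with hP
      · exact not_sees_two_of_P u hu hP ⟨x, ⟨hx, hvx⟩, hux, h.symm⟩
      · exact hP (Or.inl ⟨x, ⟨hx, hvx⟩, hux, h.symm⟩)
    refine ⟨C, fun z => ?_, fun z z' h => ?_, C_self⟩
    · by_cases hz : z = v
      · exact Or.inl (hz ▸ C_self)
      · by_cases hvz : G.Adj v z
        · rw [C_nbr z hvz]
          split_ifs <;> decide
        · rw [C_far z hz hvz]
          exact hc z ⟨hz, hvz⟩
    · by_cases hz : z = v
      · subst hz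
        exact C_self_nbr z' h
      by_cases hz' : z' = v
      · subst hz'
        exact (C_self_nbr z h.symm).symm
      by_cases hvz : G.Adj v z <;> by_cases hvz' : G.Adj v z'
      · rw [C_nbr z hvz, C_nbr z' hvz']
        have := P_edge z z' hvz hvz' h
        by_cases hP : P z'
        · rw [if_neg fun hz => this.1 hz hP, if_pos hP]
          decide
        · rw [if_pos (this.2 hP), if_neg hP]
          decide
      · exact C_nbr_far z z' hvz hz' hvz' h
      · exact (C_nbr_far z' z hvz' hz hvz h.symm).symm
      · rw [C_far z hz hvz, C_far z' hz' hvz']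
        exact hadj z ⟨hz, hvz⟩ z' ⟨hz', hvz'⟩ h
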